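/- Let A be a unital C*-algebra, I a closed two-sided ideal of A, x ∈ A self-adjoint with ‖x‖ ≤ 1, and c ∈ A such that (1 − x²)·c ∈ I. Then for every continuous function h : [−1,1] → ℂ with h(−1) = h(1) = 0, the element h(x)·c belongs to I, where h(x) is defined via the continuous functional calculus. -/

import Mathlib

/-- For a closed two-sided ideal `I` and an element `c`, the continuous functions `f` on the
spectrum of a normal element `a` such that `f(a) * c ∈ I` form an ideal. -/
def cfcHomMulMemIdeal {A : Type*} [CStarAlgebra A] (I : TwoSidedIdeal A) {a : A}
    (ha : IsStarNormal a) (c : A) : Ideal C(spectrum ℂ a, ℂ) where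
  carrier := {f | cfcHom ha f * c ∈ I}
  add_mem' {f g} hf hg := by
    simpa [add_mul] using I.add_mem hf hg
  zero_mem' := by simp [I.zero_mem]
  smul_mem' f g hg := by
    simpa [mul_assoc] using I.mul_mem_left (cfcHom ha f) _ hg

lemma isClosed_cfcHomMulMemIdeal {A : Type*} [CStarAlgebra A] {I : TwoSidedIdeal A}
    (hI : IsClosed (I : Set A)) {a : A} (ha : IsStarNormal a) (c : A) :
    IsClosed (cfcHomMulMemIdeal I ha c : Set C(spectrum ℂ a, ℂ)) :=
  hI.preimage ((cfcHom_continuous ha).mul continuous_const)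

/-- If `g(a) * c` lies in a closed two-sided ideal and `h` vanishes at every point of the spectrum
of `a` at which `g` vanishes, then `h(a) * c` lies in that ideal. -/
lemma cfcHom_mul_mem_of_forall_eq_zero {A : Type*} [CStarAlgebra A] {I : TwoSidedIdeal A}
    (hI : IsClosed (I : Set A)) {a : A} (ha : IsStarNormal a) {c : A}
    {g h : C(spectrum ℂ a, ℂ)} (hg : cfcHom ha g * c ∈ I) (hgh : ∀ z, g z = 0 → h z = 0) :
    cfcHom ha h * c ∈ I := by
  have : CompactSpace (spectrum ℂ a) := isCompact_iff_compactSpace.mp (spectrum.isCompact a)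
  suffices h ∈ cfcHomMulMemIdeal I ha c from this
  rw [← ContinuousMap.idealOfSet_ofIdeal_isClosed (isClosed_cfcHomMulMemIdeal hI ha c),
    ContinuousMap.mem_idealOfSet]
  intro z hz
  exact hgh z (ContinuousMap.notMem_setOfIdeal.mp hz hg)

/-- Let `A` be a unital C*-algebra, `I` a closed two-sided ideal, `x ∈ A` selfadjoint
with `‖x‖ ≤ 1` and `c ∈ A` with `(1 − x²)·c ∈ I`.  Then for every continuous function
`h` on `[−1,1] ⊆ ℂ` with `h(−1) = h(1) = 0`, the element `h(x)·c` (with `h(x)` given by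
the continuous functional calculus) belongs to `I`. -/
theorem cfc_mul_mem_ideal {A : Type*} [CStarAlgebra A] (I : TwoSidedIdeal A)
    (hI : IsClosed (I : Set A)) (x c : A) (hx : IsSelfAdjoint x) (hx1 : ‖x‖ ≤ 1)
    (hc : (1 - x ^ 2) * c ∈ I) (h : ℂ → ℂ)
    (hcont : ContinuousOn h ((fun r : ℝ => (r : ℂ)) '' Set.Icc (-1 : ℝ) 1))
    (hm1 : h (-1) = 0) (hp1 : h 1 = 0) :
    cfc h x * c ∈ I := by
  have hspec : spectrum ℂ x ⊆ (fun r : ℝ => (r : ℂ)) '' Set.Icc (-1 : ℝ) 1 := by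
    intro z hz
    have hre : z = z.re := hx.mem_spectrum_eq_re hz
    have hnorm : ‖z‖ ≤ 1 := by
      rcases subsingleton_or_nontrivial A with _ | _
      · simp [spectrum.of_subsingleton] at hz
      · exact (spectrum.norm_le_norm_of_mem hz).trans hx1
    exact ⟨z.re, abs_le.mp ((Complex.abs_re_le_norm z).trans hnorm), hre.symm⟩
  have hn : IsStarNormal x := hx.isStarNormal
  rw [cfc_apply h x hn (hcont.mono hspec)]
  refine cfcHom_mul_mem_of_forall_eq_zero hI hn
    (g := 1 - ((ContinuousMap.id ℂ).restrict (spectrum ℂ x)) ^ 2) ?_ ?_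
  · simpa only [map_sub, map_one, map_pow, cfcHom_id hn] using hc
  · rintro ⟨z, hz⟩ hgz
    have hsq : z ^ 2 = 1 := (sub_eq_zero.mp (by simpa using hgz)).symm
    rcases sq_eq_one_iff.mp hsq with rfl | rfl
    · exact hp1
    · exact hm1
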